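/- arXiv:1710.00417 — 8 statements merged into one kernel-verified Lean document; each statement's English description precedes it below -/
import Mathlib

section
/- Let d ≥ 1, let u = (ρ, m, E) ∈ ℝ × ℝ^d × ℝ with ρ > 0, and let (ϱ, p, a) ∈ ℝ × ℝ^d × ℝ be a direction. Then the real function t ↦ (E + t a) − ‖m + t p‖²/(2(ρ + t ϱ)), defined for t near 0, has second derivative at t = 0 equal to −(1/ρ) ‖(ϱ/ρ) m − p‖². -/
theorem hasDerivAt_affine_sub_quadratic_div {ρ ϱ t : ℝ} (E a A B C : ℝ) (ht : ρ + t * ϱ ≠ 0) :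
    HasDerivAt (fun s : ℝ => (E + s * a) - (A + 2 * s * B + s ^ 2 * C) / (2 * (ρ + s * ϱ)))
      (a - ((2 * B + 2 * t * C) * (2 * (ρ + t * ϱ)) - (A + 2 * t * B + t ^ 2 * C) * (2 * ϱ)) /
        (2 * (ρ + t * ϱ)) ^ 2) t := by
  have hid := hasDerivAt_id' t
  have hlin : HasDerivAt (fun s : ℝ => E + s * a) a t := by
    simpa using (hid.mul_const a).const_add E
  have hnum : HasDerivAt (fun s : ℝ => A + 2 * s * B + s ^ 2 * C) (2 * B + 2 * t * C) t := by
    simpa using ((((hid.const_mul 2).mul_const B).const_add A).fun_add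
      ((hid.fun_pow 2).mul_const C))
  have hden : HasDerivAt (fun s : ℝ => 2 * (ρ + s * ϱ)) (2 * ϱ) t := by
    simpa using ((hid.mul_const ϱ).const_add ρ).const_mul 2
  exact hlin.fun_sub (hnum.fun_div hden (mul_ne_zero two_ne_zero ht))

theorem deriv_deriv_affine_sub_quadratic_div {ρ : ℝ} (hρ : ρ ≠ 0) (ϱ E a A B C : ℝ) :
    deriv (deriv (fun s : ℝ =>
        (E + s * a) - (A + 2 * s * B + s ^ 2 * C) / (2 * (ρ + s * ϱ)))) 0
      = -(1 / ρ) * ((ϱ / ρ) ^ 2 * A - 2 * (ϱ / ρ) * B + C) := by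
  have hev : ∀ᶠ t : ℝ in nhds 0, ρ + t * ϱ ≠ 0 :=
    ContinuousAt.eventually_ne (by fun_prop) (by simpa using hρ)
  have hderiv := hev.mono fun t ht =>
    (hasDerivAt_affine_sub_quadratic_div E a A B C ht).deriv
  rw [Filter.EventuallyEq.deriv_eq hderiv]
  have hid := hasDerivAt_id' (0 : ℝ)
  have hden : HasDerivAt (fun s : ℝ => 2 * (ρ + s * ϱ)) (2 * ϱ) 0 := by
    simpa using ((hid.mul_const ϱ).const_add ρ).const_mul 2
  have hnum' : HasDerivAt (fun s : ℝ => 2 * B + 2 * s * C) (2 * C) 0 := by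
    simpa using ((hid.const_mul 2).mul_const C).const_add (2 * B)
  have hnum : HasDerivAt (fun s : ℝ => A + 2 * s * B + s ^ 2 * C) (2 * B) 0 := by
    simpa using ((((hid.const_mul 2).mul_const B).const_add A).fun_add
      ((hid.fun_pow 2).mul_const C))
  have hne : (2 * (ρ + 0 * ϱ)) ^ 2 ≠ 0 := by simpa using hρ
  rw [(((hnum'.fun_mul hden).fun_sub (hnum.mul_const (2 * ϱ))).fun_div
    (hden.fun_pow 2) hne |>.const_sub a).deriv]
  simp only [zero_mul, mul_zero, add_zero, ne_eq, OfNat.ofNat_ne_zero, not_false_eq_true, zero_pow]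
  field_simp
  ring

/-- Second derivative of the internal energy along a direction: for conservative
variables `u = (ρ, m, E)` with `ρ > 0` and a direction `(ϱ, p, a)`, the real
function `t ↦ (E + t a) − ‖m + t p‖²/(2(ρ + t ϱ))` has second derivative at
`t = 0` equal to `−(1/ρ) ‖(ϱ/ρ) m − p‖²`. -/
theorem internalEnergy_secondDeriv
    (d : ℕ) (hd : 1 ≤ d)
    (ρ E : ℝ) (m : EuclideanSpace ℝ (Fin d)) (hρ : 0 < ρ)
    (ϱ a : ℝ) (p : EuclideanSpace ℝ (Fin d)) :
    deriv (deriv (fun t : ℝ => (E + t * a) - ‖m + t • p‖ ^ 2 / (2 * (ρ + t * ϱ)))) 0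
      = -(1 / ρ) * ‖(ϱ / ρ) • m - p‖ ^ 2 := by
  have hexp : ∀ t : ℝ, ‖m + t • p‖ ^ 2 = ‖m‖ ^ 2 + 2 * t * inner ℝ m p + t ^ 2 * ‖p‖ ^ 2 := by
    intro t
    rw [norm_add_sq_real, inner_smul_right, norm_smul, mul_pow, Real.norm_eq_abs, sq_abs]
    ring
  simp only [hexp]
  rw [deriv_deriv_affine_sub_quadratic_div hρ.ne', norm_sub_sq_real, real_inner_smul_left,
    norm_smul, mul_pow, Real.norm_eq_abs, sq_abs]
  ring
end

section
/- Let d ≥ 1. The set {(ρ, m, E) ∈ ℝ × ℝ^d × ℝ : ρ > 0 and E − ‖m‖²/(2ρ) > 0} is convex. -/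
/-- Joint convexity of the quadratic-over-linear function `(r, p) ↦ p² / (2r)` on `r > 0`. -/
theorem sq_div_two_mul_convex_comb_le {a b r s : ℝ} (p q : ℝ) (ha : 0 ≤ a) (hb : 0 ≤ b)
    (hr : 0 < r) (hs : 0 < s) (h : 0 < a * r + b * s) :
    (a * p + b * q) ^ 2 / (2 * (a * r + b * s)) ≤
      a * (p ^ 2 / (2 * r)) + b * (q ^ 2 / (2 * s)) := by
  obtain ⟨x, rfl⟩ : ∃ x, p = r * x := ⟨p / r, by field_simp⟩
  obtain ⟨y, rfl⟩ : ∃ y, q = s * y := ⟨q / s, by field_simp⟩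
  have hx : (r * x) ^ 2 / (2 * r) = r * x ^ 2 / 2 := by field_simp
  have hy : (s * y) ^ 2 / (2 * s) = s * y ^ 2 / 2 := by field_simp
  rw [hx, hy, div_le_iff₀ (by positivity)]
  have key : 0 ≤ a * b * (r * s) * (x - y) ^ 2 := by positivity
  linarith

/-- The set of conservative variables with positive density and positive
internal energy, `{(ρ, m, E) : ρ > 0 and E − ‖m‖²/(2ρ) > 0}`, is convex. -/
theorem positiveInternalEnergy_convex
    (d : ℕ) (hd : 1 ≤ d) :
    Convex ℝ {u : ℝ × EuclideanSpace ℝ (Fin d) × ℝ |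
      0 < u.1 ∧ 0 < u.2.2 - ‖u.2.1‖ ^ 2 / (2 * u.1)} := by
  rintro ⟨r, m, E⟩ ⟨hr, hE⟩ ⟨s, n, F⟩ ⟨hs, hF⟩ a b ha hb hab
  dsimp only at hr hE hs hF
  have hpos : 0 < a * r + b * s := convex_Ioi (0 : ℝ) hr hs ha hb hab
  refine ⟨hpos, ?_⟩
  change 0 < (a * E + b * F) - ‖a • m + b • n‖ ^ 2 / (2 * (a * r + b * s))
  have hnorm : ‖a • m + b • n‖ ≤ a * ‖m‖ + b * ‖n‖ := by
    simpa [norm_smul, abs_of_nonneg ha, abs_of_nonneg hb] using norm_add_le (a • m) (b • n)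
  have hquad : ‖a • m + b • n‖ ^ 2 / (2 * (a * r + b * s)) ≤
      (a * ‖m‖ + b * ‖n‖) ^ 2 / (2 * (a * r + b * s)) := by gcongr
  have hcomb := sq_div_two_mul_convex_comb_le ‖m‖ ‖n‖ ha hb hr hs hpos
  have hconv : 0 < a * (E - ‖m‖ ^ 2 / (2 * r)) + b * (F - ‖n‖ ^ 2 / (2 * s)) :=
    convex_Ioi (0 : ℝ) hE hF ha hb hab
  linarith
end

section
/- Let d ≥ 1, γ > 1, and c > 0. The set A := {(ρ, m, E) ∈ ℝ × ℝ^d × ℝ : ρ > 0 and E − ‖m‖²/(2ρ) ≥ c ρ^γ} is convex. -/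
/-- Joint convexity of the kinetic energy `(ρ, m) ↦ ‖m‖² / (2ρ)` on `ρ > 0`. -/
theorem convexOn_norm_sq_div_two_mul {V : Type*} [SeminormedAddCommGroup V] [NormedSpace ℝ V] :
    ConvexOn ℝ {p : ℝ × V | 0 < p.1} (fun p => ‖p.2‖ ^ 2 / (2 * p.1)) := by
  refine ⟨(convex_Ioi (0 : ℝ)).linear_preimage (LinearMap.fst ℝ ℝ V), ?_⟩
  rintro ⟨r, x⟩ hr ⟨s, y⟩ hs a b ha hb hab
  simp only [Set.mem_ofPred_eq] at hr hs
  have hpos : 0 < a * r + b * s :=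
    (convex_Ioi (0 : ℝ)) (Set.mem_Ioi.mpr hr) (Set.mem_Ioi.mpr hs) ha hb hab
  have hnorm : ‖a • x + b • y‖ ≤ a * ‖x‖ + b * ‖y‖ :=
    (norm_add_le _ _).trans_eq (by rw [norm_smul_of_nonneg ha, norm_smul_of_nonneg hb])
  simp only [Prod.smul_mk, Prod.mk_add_mk, smul_eq_mul]
  calc ‖a • x + b • y‖ ^ 2 / (2 * (a * r + b * s))
      ≤ (a * ‖x‖ + b * ‖y‖) ^ 2 / (2 * (a * r + b * s)) := by gcongr
    _ ≤ a * (‖x‖ ^ 2 / (2 * r)) + b * (‖y‖ ^ 2 / (2 * s)) := by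
      rw [← sub_nonneg]
      have key : a * (‖x‖ ^ 2 / (2 * r)) + b * (‖y‖ ^ 2 / (2 * s)) -
          (a * ‖x‖ + b * ‖y‖) ^ 2 / (2 * (a * r + b * s)) =
          a * b * (‖x‖ * s - ‖y‖ * r) ^ 2 / (2 * r * s * (a * r + b * s)) := by
        field_simp
        ring
      rw [key]
      positivity


/-- For a polytropic ideal gas, the invariant set
`A = {(ρ, m, E) : ρ > 0 and E − ‖m‖²/(2ρ) ≥ c ρ^γ}` (with `γ > 1`, `c > 0`)
is convex. -/
theorem invariantSet_polytropic_convex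
    (d : ℕ) (hd : 1 ≤ d) (γ : ℝ) (hγ : 1 < γ) (c : ℝ) (hc : 0 < c) :
    Convex ℝ {u : ℝ × EuclideanSpace ℝ (Fin d) × ℝ |
      0 < u.1 ∧ c * u.1 ^ γ ≤ u.2.2 - ‖u.2.1‖ ^ 2 / (2 * u.1)} := by
  rintro ⟨r, x, E⟩ ⟨hr, hE⟩ ⟨s, y, F⟩ ⟨hs, hF⟩ a b ha hb hab
  simp only at hr hE hs hF
  have hpow := (convexOn_rpow hγ.le).2 (Set.mem_Ici.mpr hr.le) (Set.mem_Ici.mpr hs.le) ha hb hab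
  have hkin := (convexOn_norm_sq_div_two_mul (V := EuclideanSpace ℝ (Fin d))).2
    (show (r, x) ∈ _ from hr) (show (s, y) ∈ _ from hs) ha hb hab
  simp only [Prod.smul_mk, Prod.mk_add_mk, smul_eq_mul] at hpow hkin
  refine ⟨(convex_Ioi (0 : ℝ)) (Set.mem_Ioi.mpr hr) (Set.mem_Ioi.mpr hs) ha hb hab, ?_⟩
  simp only [Prod.smul_mk, Prod.mk_add_mk, smul_eq_mul]
  linarith [mul_le_mul_of_nonneg_left hpow hc.le, mul_le_mul_of_nonneg_left hE ha,
    mul_le_mul_of_nonneg_left hF hb]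
end

section
/- Let d ≥ 1 and γ > 1. The specific entropy of a polytropic ideal gas expressed in conservative variables, Φ(ρ, m, E) := (1/(γ−1)) log(E/ρ − ‖m‖²/(2ρ²)) − log ρ, is quasiconcave on the convex set {(ρ, m, E) ∈ ℝ × ℝ^d × ℝ : ρ > 0 and E − ‖m‖²/(2ρ) > 0}, i.e., every upper level set {u : Φ(u) ≥ λ} is convex. -/
/-- The quadratic-over-linear function `(ρ, m) ↦ ‖m‖² / ρ` is convex on `ρ > 0`. -/
theorem convexOn_norm_sq_div {V : Type*} [SeminormedAddCommGroup V] [NormedSpace ℝ V] :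
    ConvexOn ℝ {u : ℝ × V | 0 < u.1} fun u => ‖u.2‖ ^ 2 / u.1 := by
  refine ⟨(convex_Ioi (0 : ℝ)).is_linear_preimage (IsLinearMap.mk (fun _ _ => rfl)
    fun _ _ => rfl : IsLinearMap ℝ (Prod.fst : ℝ × V → ℝ)), ?_⟩
  rintro ⟨ρ, x⟩ (hρ : 0 < ρ) ⟨σ, y⟩ (hσ : 0 < σ) a b ha hb hab
  have hpos : 0 < a * ρ + b * σ := convex_Ioi (0 : ℝ) hρ hσ ha hb hab
  simp only [Prod.smul_mk, Prod.mk_add_mk, smul_eq_mul]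
  have htri : ‖a • x + b • y‖ ≤ a * ‖x‖ + b * ‖y‖ := by
    simpa [norm_smul, abs_of_nonneg ha, abs_of_nonneg hb] using norm_add_le (a • x) (b • y)
  rw [div_le_iff₀ hpos]
  refine (pow_le_pow_left₀ (norm_nonneg _) htri 2).trans ?_
  have hdiff : (a * (‖x‖ ^ 2 / ρ) + b * (‖y‖ ^ 2 / σ)) * (a * ρ + b * σ)
      - (a * ‖x‖ + b * ‖y‖) ^ 2 = a * b * ρ * σ * (‖x‖ / ρ - ‖y‖ / σ) ^ 2 := by
    field_simp
    ring
  have : 0 ≤ a * b * ρ * σ * (‖x‖ / ρ - ‖y‖ / σ) ^ 2 := by positivity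
  linarith

/-- An entropy lower bound is a lower bound on the energy density `E` by the sum of the
kinetic energy density and a multiple of `ρ ^ γ`. -/
theorem le_specificEntropy_iff {γ : ℝ} (hγ : 1 < γ) (lam ρ k E : ℝ) :
    ((0 < ρ ∧ 0 < E - k / (2 * ρ)) ∧
        lam ≤ (1 / (γ - 1)) * Real.log (E / ρ - k / (2 * ρ ^ 2)) - Real.log ρ) ↔
      0 < ρ ∧ k / ρ / 2 + Real.exp ((γ - 1) * lam) * ρ ^ γ ≤ E := by
  have key (hρ : 0 < ρ) (he : 0 < E - k / (2 * ρ)) :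
      lam ≤ (1 / (γ - 1)) * Real.log (E / ρ - k / (2 * ρ ^ 2)) - Real.log ρ ↔
        k / ρ / 2 + Real.exp ((γ - 1) * lam) * ρ ^ γ ≤ E := by
    have hγ' : 0 < γ - 1 := sub_pos.2 hγ
    have hk : k / (2 * ρ) = k / ρ / 2 := by field_simp
    have hdiv : E / ρ - k / (2 * ρ ^ 2) = (E - k / (2 * ρ)) / ρ := by field_simp
    rw [hdiv, Real.log_div he.ne' hρ.ne', Real.rpow_def_of_pos hρ, ← Real.exp_add,
      ← le_sub_iff_add_le', ← hk, ← Real.le_log_iff_exp_le he, le_sub_iff_add_le,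
      one_div_mul_eq_div, le_div_iff₀ hγ']
    constructor <;> intro h <;> linarith
  constructor
  · rintro ⟨⟨hρ, he⟩, h⟩
    exact ⟨hρ, (key hρ he).1 h⟩
  · rintro ⟨hρ, h⟩
    have he : 0 < E - k / (2 * ρ) := by
      have hk : k / (2 * ρ) = k / ρ / 2 := by field_simp
      have : 0 < Real.exp ((γ - 1) * lam) * ρ ^ γ := by positivity
      linarith
    exact ⟨⟨hρ, he⟩, (key hρ he).2 h⟩

/-- The specific entropy of a polytropic ideal gas expressed in conservative
variables, `Φ(ρ, m, E) = (1/(γ−1)) log(E/ρ − ‖m‖²/(2ρ²)) − log ρ`, is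
quasiconcave on the convex set `{ρ > 0, E − ‖m‖²/(2ρ) > 0}`: every upper level
set is convex. -/
theorem specificEntropy_quasiconcave
    (d : ℕ) (hd : 1 ≤ d) (γ : ℝ) (hγ : 1 < γ) :
    ∀ lam : ℝ,
      Convex ℝ {u : ℝ × EuclideanSpace ℝ (Fin d) × ℝ |
        (0 < u.1 ∧ 0 < u.2.2 - ‖u.2.1‖ ^ 2 / (2 * u.1)) ∧
        lam ≤ (1 / (γ - 1)) * Real.log (u.2.2 / u.1 - ‖u.2.1‖ ^ 2 / (2 * u.1 ^ 2))
                - Real.log u.1} := by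
  intro lam
  simp only [le_specificEntropy_iff hγ]
  rintro ⟨ρ, x, E⟩ ⟨hρ, hE⟩ ⟨σ, y, F⟩ ⟨hσ, hF⟩ a b ha hb hab
  simp only [Set.mem_ofPred_eq, Prod.smul_mk, Prod.mk_add_mk, smul_eq_mul] at *
  refine ⟨convex_Ioi (0 : ℝ) hρ hσ ha hb hab, ?_⟩
  have hkin := convexOn_norm_sq_div.2 (x := (ρ, x)) hρ (y := (σ, y)) hσ ha hb hab
  have hpow := (convexOn_rpow hγ.le).2 (Set.mem_Ici.2 hρ.le) (Set.mem_Ici.2 hσ.le) ha hb hab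
  simp only [Prod.smul_mk, Prod.mk_add_mk, smul_eq_mul] at hkin hpow
  have hpow' := mul_le_mul_of_nonneg_left hpow (Real.exp_pos ((γ - 1) * lam)).le
  have hE' := mul_le_mul_of_nonneg_left hE ha
  have hF' := mul_le_mul_of_nonneg_left hF hb
  linarith
end

section
/- Let X be a real vector space, J a finite index set with a distinguished element i ∈ J, Δt > 0 and m_i > 0 real numbers, and for each j ∈ J let U_j ∈ X, let f_j : ℝ^d → X be linear maps, and let c_j ∈ ℝ^d satisfy ∑_{j∈J} c_j = 0. Let d_j > 0 for each j ∈ J with j ≠ i. Define the low-order update U^L := U_i − (Δt/m_i) ∑_{j∈J, j≠i} ( f_j(c_j) − d_j (U_j − U_i) ) − (Δt/m_i) f_i(c_i), and define for j ≠ i the bar states Ū_j := (1/2)(U_i + U_j) − (1/(2 d_j)) ( f_j(c_j) − f_i(c_j) ). Then U^L = (1 − ∑_{j≠i} 2Δt d_j/m_i) U_i + ∑_{j≠i} (2Δt d_j/m_i) Ū_j, and the coefficients in this representation sum to one. -/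
open Finset

/-- Convex-combination representation of the low-order graph-viscosity update:
with `f j` the linear map `c ↦ 𝐟(U_j)·c`, `∑ j, c j = 0`, and positive graph
viscosities `dv j` for `j ≠ i`, the low-order update
`U^L = U_i − (Δt/m_i) ∑_{j≠i} (f_j(c_j) − dv_j (U_j − U_i)) − (Δt/m_i) f_i(c_i)`
equals `(1 − ∑_{j≠i} 2Δt dv_j/m_i) U_i + ∑_{j≠i} (2Δt dv_j/m_i) Ū_j` where
`Ū_j = ½(U_i + U_j) − (f_j(c_j) − f_i(c_j))/(2 dv_j)`, and the coefficients of
this representation sum to one. -/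
theorem lowOrder_convexCombination_barStates
    {X : Type*} [AddCommGroup X] [Module ℝ X]
    {ι : Type*} [Fintype ι] [DecidableEq ι] (i : ι)
    {d : ℕ} (Δt mi : ℝ) (hΔt : 0 < Δt) (hmi : 0 < mi)
    (U : ι → X) (f : ι → (Fin d → ℝ) →ₗ[ℝ] X)
    (c : ι → (Fin d → ℝ)) (hc : ∑ j, c j = 0)
    (dv : ι → ℝ) (hdv : ∀ j, j ≠ i → 0 < dv j)
    (UL : X)
    (hUL : UL = U i
      - (Δt / mi) • (∑ j ∈ univ.erase i, (f j (c j) - dv j • (U j - U i)))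
      - (Δt / mi) • f i (c i))
    (Ubar : ι → X)
    (hUbar : ∀ j, j ≠ i →
      Ubar j = (1 / 2 : ℝ) • (U i + U j)
        - (1 / (2 * dv j)) • (f j (c j) - f i (c j))) :
    UL = (1 - ∑ j ∈ univ.erase i, 2 * Δt * dv j / mi) • U i
        + ∑ j ∈ univ.erase i, (2 * Δt * dv j / mi) • Ubar j
      ∧ (1 - ∑ j ∈ univ.erase i, 2 * Δt * dv j / mi)
        + ∑ j ∈ univ.erase i, 2 * Δt * dv j / mi = 1 := by
  have h_erase : ∑ j ∈ univ.erase i, f i (c j) = -f i (c i) := by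
    rw [eq_neg_iff_add_eq_zero, sum_erase_add _ _ (mem_univ i), ← map_sum, hc, map_zero]
  have h_bar : ∀ j ∈ univ.erase i, (2 * Δt * dv j / mi) • Ubar j =
      (2 * Δt * dv j / mi) • U i - (Δt / mi) • (f j (c j) - dv j • (U j - U i))
        + (Δt / mi) • f i (c j) := by
    intro j hj
    have hji := ne_of_mem_erase hj
    have hd := (hdv j hji).ne'
    rw [hUbar j hji]
    match_scalars <;> field_simp <;> ring
  refine ⟨?_, sub_add_cancel _ _⟩
  rw [sum_congr rfl h_bar, sum_add_distrib, sum_sub_distrib, ← sum_smul, ← smul_sum,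
    ← smul_sum, h_erase, hUL]
  module
end

section
/- Let ρ^min ≤ ρ ≤ ρ^max be real numbers, let ε > 0, and let P ∈ ℝ. Define ℓ := min(|ρ^min − ρ|/(|P| + ε), 1) if ρ + P < ρ^min; ℓ := 1 if ρ^min ≤ ρ + P ≤ ρ^max; and ℓ := min(|ρ^max − ρ|/(|P| + ε), 1) if ρ^max < ρ + P. Then for every ℓ' ∈ [0, ℓ], one has ρ^min ≤ ρ + ℓ' P ≤ ρ^max. -/
/-- The explicit density limiter: given `ρ^min ≤ ρ ≤ ρ^max`, `ε > 0`, and an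
antidiffusive density correction `P`, the limiter `ℓ` defined by the three-case
formula guarantees `ρ^min ≤ ρ + ℓ' P ≤ ρ^max` for every `ℓ' ∈ [0, ℓ]`. -/
theorem density_limiter_bounds
    (ρmin ρ ρmax : ℝ) (hmin : ρmin ≤ ρ) (hmax : ρ ≤ ρmax)
    (ε : ℝ) (hε : 0 < ε) (P : ℝ) (ℓ : ℝ)
    (hℓ₁ : ρ + P < ρmin → ℓ = min (|ρmin - ρ| / (|P| + ε)) 1)
    (hℓ₂ : ρmin ≤ ρ + P → ρ + P ≤ ρmax → ℓ = 1)
    (hℓ₃ : ρmax < ρ + P → ℓ = min (|ρmax - ρ| / (|P| + ε)) 1) :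
    ∀ ℓ' ∈ Set.Icc (0:ℝ) ℓ, ρmin ≤ ρ + ℓ' * P ∧ ρ + ℓ' * P ≤ ρmax := by
  rintro ℓ' ⟨h0, hle⟩
  have mul_le_of_le_min : ∀ d : ℝ, ℓ' ≤ min (|d| / (|P| + ε)) 1 → ℓ' * |P| ≤ |d| := by
    intro d hd
    have hpos : 0 < |P| + ε := by positivity
    have h := (le_div_iff₀ hpos).1 (hd.trans (min_le_left _ _))
    nlinarith [mul_nonneg h0 hε.le]
  rcases lt_or_ge (ρ + P) ρmin with h₁ | h₁
  · have h := mul_le_of_le_min _ (hle.trans_eq (hℓ₁ h₁))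
    rw [abs_of_nonpos (by linarith : P ≤ 0), abs_of_nonpos (by linarith : ρmin - ρ ≤ 0)] at h
    have hP : ℓ' * P ≤ 0 := mul_nonpos_of_nonneg_of_nonpos h0 (by linarith)
    constructor <;> linarith
  rcases lt_or_ge ρmax (ρ + P) with h₂ | h₂
  · have h := mul_le_of_le_min _ (hle.trans_eq (hℓ₃ h₂))
    rw [abs_of_nonneg (by linarith : 0 ≤ P), abs_of_nonneg (by linarith : 0 ≤ ρmax - ρ)] at h
    have hP : 0 ≤ ℓ' * P := mul_nonneg h0 (by linarith)
    constructor <;> linarith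
  · have h1 : ℓ' ≤ 1 := hle.trans_eq (hℓ₂ h₁ h₂)
    constructor <;> nlinarith
end

section
/- Let E, Y, Z be real normed vector spaces, let S ⊆ E be an open convex set, and let u, v ∈ S. Let F : E → Z and g : E → Y be twice continuously differentiable on S. Let L : E → (Y →L Z) (continuous linear maps from Y to Z) be such that the chain-type identity DF(w) = L(w) ∘ Dg(w) holds for all w ∈ S. Assume ‖D²F(w)‖ ≤ M_F and ‖D²g(w)‖ ≤ M_g for all w on the segment [u, v]. Then ‖F(v) − F(u) − L(u)(g(v) − g(u))‖ ≤ (1/2) (M_F + ‖L(u)‖ M_g) ‖v − u‖². -/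
/-- Second-order Taylor estimate along a segment, with the sharp constant `1 / 2`. -/
theorem norm_sub_sub_fderiv_le_of_norm_iteratedFDeriv_two_le
    {E G : Type*} [NormedAddCommGroup E] [NormedSpace ℝ E]
    [NormedAddCommGroup G] [NormedSpace ℝ G]
    {f : E → G} {u v : E} {M : ℝ}
    (hf : ∀ w ∈ segment ℝ u v, ContDiffAt ℝ 2 f w)
    (hM : ∀ w ∈ segment ℝ u v, ‖iteratedFDeriv ℝ 2 f w‖ ≤ M) :
    ‖f v - f u - fderiv ℝ f u (v - u)‖ ≤ 1 / 2 * M * ‖v - u‖ ^ 2 := by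
  have hu : u ∈ segment ℝ u v := left_mem_segment ℝ u v
  have hfderiv : ∀ w ∈ segment ℝ u v, ‖fderiv ℝ f w - fderiv ℝ f u‖ ≤ M * ‖w - u‖ := by
    intro w hw
    refine (convex_segment u v).norm_image_sub_le_of_norm_hasFDerivWithin_le
      (f' := fderiv ℝ (fderiv ℝ f)) (fun x hx => ?_) (fun x hx => ?_) hu hw
    · exact (((hf x hx).fderiv_right (m := 1) (by norm_num)).differentiableAt
        (by norm_num)).hasFDerivAt.hasFDerivWithinAt
    · rw [← norm_iteratedFDeriv_one, norm_iteratedFDeriv_fderiv]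
      exact hM x hx
  have hmem : ∀ t ∈ Set.Icc (0 : ℝ) 1, u + t • (v - u) ∈ segment ℝ u v := by
    intro t ht
    rw [segment_eq_image']
    exact ⟨t, ht, rfl⟩
  have hderiv : ∀ t ∈ Set.Icc (0 : ℝ) 1,
      HasDerivAt (fun t : ℝ => f (u + t • (v - u)) - f u - t • fderiv ℝ f u (v - u))
        (fderiv ℝ f (u + t • (v - u)) (v - u) - fderiv ℝ f u (v - u)) t := by
    intro t ht
    have hline : HasDerivAt (fun t : ℝ => u + t • (v - u)) (v - u) t := by
      simpa using ((hasDerivAt_id t).smul_const (v - u)).const_add u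
    have hcomp := ((hf _ (hmem t ht)).differentiableAt
      (by norm_num)).hasFDerivAt.comp_hasDerivAt t hline
    have hlin : HasDerivAt (fun t : ℝ => t • fderiv ℝ f u (v - u))
        (fderiv ℝ f u (v - u)) t := by
      simpa using (hasDerivAt_id t).smul_const (fderiv ℝ f u (v - u))
    exact (hcomp.sub_const (f u)).sub hlin
  have hbound := image_norm_le_of_norm_deriv_right_le_deriv_boundary
    (a := (0 : ℝ)) (b := 1)
    (B := fun t => 1 / 2 * M * ‖v - u‖ ^ 2 * t ^ 2)
    (B' := fun t => M * ‖v - u‖ ^ 2 * t)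
    (fun t ht => (hderiv t ht).continuousAt.continuousWithinAt)
    (fun t ht => (hderiv t (Set.Ico_subset_Icc_self ht)).hasDerivWithinAt)
    (by simp)
    (fun t => ((hasDerivAt_pow 2 t).const_mul (1 / 2 * M * ‖v - u‖ ^ 2)).congr_deriv
      (by norm_num; ring))
    (fun t ht => by
      have h := hfderiv _ (hmem t (Set.Ico_subset_Icc_self ht))
      rw [add_sub_cancel_left, norm_smul, Real.norm_of_nonneg ht.1] at h
      calc ‖fderiv ℝ f (u + t • (v - u)) (v - u) - fderiv ℝ f u (v - u)‖
          = ‖(fderiv ℝ f (u + t • (v - u)) - fderiv ℝ f u) (v - u)‖ := by simp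
        _ ≤ M * (t * ‖v - u‖) * ‖v - u‖ := ContinuousLinearMap.le_of_opNorm_le _ h _
        _ = M * ‖v - u‖ ^ 2 * t := by ring)
    (Set.right_mem_Icc.2 zero_le_one)
  simpa using hbound


/-- Second-order Taylor estimate for the entropy-viscosity commutator: if
`F : E → Z` and `g : E → Y` are twice continuously differentiable on an open
convex set `S`, the chain-type identity `DF(w) = L(w) ∘ Dg(w)` holds on `S`,
and the second derivatives are bounded by `M_F` and `M_g` on the segment
`[u, v] ⊆ S`, then
`‖F(v) − F(u) − L(u)(g(v) − g(u))‖ ≤ (1/2)(M_F + ‖L(u)‖ M_g) ‖v − u‖²`. -/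
theorem commutator_taylor_estimate
    {E Y Z : Type*} [NormedAddCommGroup E] [NormedSpace ℝ E]
    [NormedAddCommGroup Y] [NormedSpace ℝ Y]
    [NormedAddCommGroup Z] [NormedSpace ℝ Z]
    (S : Set E) (hS : IsOpen S) (hSconv : Convex ℝ S)
    (u v : E) (hu : u ∈ S) (hv : v ∈ S)
    (F : E → Z) (g : E → Y)
    (hF : ContDiffOn ℝ 2 F S) (hg : ContDiffOn ℝ 2 g S)
    (L : E → (Y →L[ℝ] Z))
    (hL : ∀ w ∈ S, fderiv ℝ F w = (L w).comp (fderiv ℝ g w))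
    (MF Mg : ℝ)
    (hMF : ∀ w ∈ segment ℝ u v, ‖iteratedFDeriv ℝ 2 F w‖ ≤ MF)
    (hMg : ∀ w ∈ segment ℝ u v, ‖iteratedFDeriv ℝ 2 g w‖ ≤ Mg) :
    ‖F v - F u - L u (g v - g u)‖
      ≤ (1 / 2) * (MF + ‖L u‖ * Mg) * ‖v - u‖ ^ 2 := by
  have hseg : segment ℝ u v ⊆ S := hSconv.segment_subset hu hv
  have hFuv := norm_sub_sub_fderiv_le_of_norm_iteratedFDeriv_two_le
    (fun w hw => hF.contDiffAt (hS.mem_nhds (hseg hw))) hMF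
  have hguv := norm_sub_sub_fderiv_le_of_norm_iteratedFDeriv_two_le
    (fun w hw => hg.contDiffAt (hS.mem_nhds (hseg hw))) hMg
  have hsplit : F v - F u - L u (g v - g u) =
      (F v - F u - fderiv ℝ F u (v - u)) - L u (g v - g u - fderiv ℝ g u (v - u)) := by
    rw [hL u hu, ContinuousLinearMap.comp_apply, map_sub (L u) (g v - g u)]
    abel
  calc ‖F v - F u - L u (g v - g u)‖
      ≤ ‖F v - F u - fderiv ℝ F u (v - u)‖ + ‖L u (g v - g u - fderiv ℝ g u (v - u))‖ := by
        rw [hsplit]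
        exact norm_sub_le _ _
    _ ≤ 1 / 2 * MF * ‖v - u‖ ^ 2 + ‖L u‖ * (1 / 2 * Mg * ‖v - u‖ ^ 2) :=
        add_le_add hFuv ((L u).le_opNorm_of_le hguv)
    _ = (1 / 2) * (MF + ‖L u‖ * Mg) * ‖v - u‖ ^ 2 := by ring
end

section
/- Let γ > 1 and b > 0. The function g(ρ) := ρ^γ / (1 − bρ)^{γ−1} is convex on the interval (0, 1/b). -/
/-- The function `x ^ p / v ^ (p - 1)` is the perspective `v * (x / v) ^ p` of `x ↦ x ^ p`. -/
lemma rpow_div_rpow_sub_one_eq_mul_div_rpow {x v : ℝ} (hx : 0 ≤ x) (hv : 0 < v) (p : ℝ) :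
    x ^ p / v ^ (p - 1) = v * (x / v) ^ p := by
  have h : v ^ p ≠ 0 := (Real.rpow_pos_of_pos hv p).ne'
  rw [Real.div_rpow hx hv.le, Real.rpow_sub_one hv.ne']
  field_simp

/-- The perspective of a convex function is jointly convex. -/
lemma ConvexOn.perspective_le {s : Set ℝ} {f : ℝ → ℝ} (hf : ConvexOn ℝ s f)
    {x y v w a c : ℝ} (hv : 0 < v) (hw : 0 < w) (hx : x / v ∈ s) (hy : y / w ∈ s)
    (ha : 0 ≤ a) (hc : 0 ≤ c) (hV : 0 < a * v + c * w) :
    (a * v + c * w) * f ((a * x + c * y) / (a * v + c * w)) ≤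
      a * (v * f (x / v)) + c * (w * f (y / w)) := by
  set V := a * v + c * w with hVdef
  have h := hf.2 hx hy (div_nonneg (mul_nonneg ha hv.le) hV.le)
    (div_nonneg (mul_nonneg hc hw.le) hV.le) (by rw [← add_div, ← hVdef, div_self hV.ne'])
  simp only [smul_eq_mul] at h
  have harg : a * v / V * (x / v) + c * w / V * (y / w) = (a * x + c * y) / V := by
    field_simp
  rw [harg] at h
  calc V * f ((a * x + c * y) / V)
      ≤ V * (a * v / V * f (x / v) + c * w / V * f (y / w)) :=
        mul_le_mul_of_nonneg_left h hV.le
    _ = a * (v * f (x / v)) + c * (w * f (y / w)) := by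
        field_simp

/-- For the covolume equation of state: with `γ > 1` and `b > 0`, the function
`g(ρ) = ρ^γ / (1 − bρ)^{γ−1}` is convex on the interval `(0, 1/b)`. -/
theorem covolume_energy_convexOn
    (γ b : ℝ) (hγ : 1 < γ) (hb : 0 < b) :
    ConvexOn ℝ (Set.Ioo (0:ℝ) (1 / b))
      (fun ρ => ρ ^ γ / (1 - b * ρ) ^ (γ - 1)) := by
  have hpos : ∀ z ∈ Set.Ioo (0:ℝ) (1 / b), 0 < 1 - b * z := fun z hz => by
    have := (lt_div_iff₀' hb).1 hz.2
    linarith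
  refine ⟨convex_Ioo _ _, fun x hx y hy a c ha hc hac => ?_⟩
  have hz := convex_Ioo (0:ℝ) (1 / b) hx hy ha hc hac
  simp only [smul_eq_mul] at hz ⊢
  have hv := hpos x hx
  have hw := hpos y hy
  have hV := hpos _ hz
  rw [rpow_div_rpow_sub_one_eq_mul_div_rpow hx.1.le hv,
    rpow_div_rpow_sub_one_eq_mul_div_rpow hy.1.le hw,
    rpow_div_rpow_sub_one_eq_mul_div_rpow hz.1.le hV]
  have hlin : 1 - b * (a * x + c * y) = a * (1 - b * x) + c * (1 - b * y) := by
    linear_combination -hac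
  rw [hlin] at hV ⊢
  exact (convexOn_rpow hγ.le).perspective_le hv hw (div_nonneg hx.1.le hv.le)
    (div_nonneg hy.1.le hw.le) ha hc hV
end
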